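/- Let q be a real number. Then for every nonnegative integer n: S_q(2n) = 2q·S_q(n) + n·q. -/

import Mathlib

noncomputable section

open MeasureTheory Filter Finset

/-- Distance from `x` to the nearest integer. -/
def distInt (x : ℝ) : ℝ := |x - round x|

/-- The Takagi–Landsberg function with parameter `a`:
`𝒯_a(x) = ∑_{n≥0} a^n · dist(2^n x, ℤ)`. -/
def takagi (a : ℝ) (x : ℝ) : ℝ := ∑' n : ℕ, a ^ n * distInt (2 ^ n * x)

/-- Weighted sum-of-binary-digits function: for `j = ∑ ω_i 2^i`,
`s_q(j) = ∑ ω_i q^{i+1}`. -/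
def sqN (q : ℝ) (j : ℕ) : ℝ := ∑ i ∈ Finset.range j, if j.testBit i then q ^ (i + 1) else 0

/-- `S_q(n) = ∑_{j<n} s_q(j)`. -/
def Sq (q : ℝ) (n : ℕ) : ℝ := ∑ j ∈ Finset.range n, sqN q j

/-- Digits at positions `≥ j` vanish, so the defining sum may be taken over any longer range. -/
theorem sqN_eq_sum_range (q : ℝ) {j N : ℕ} (h : j ≤ N) :
    sqN q j = ∑ i ∈ Finset.range N, if j.testBit i then q ^ (i + 1) else 0 := by
  refine Finset.sum_subset (Finset.range_mono h) fun i _ hi => ?_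
  have hij : j ≤ i := by simpa using hi
  have hlt : j < 2 ^ i := hij.trans_lt Nat.lt_two_pow_self
  simp [Nat.testBit_lt_two_pow hlt]

theorem sqN_eq_div_two (q : ℝ) (j : ℕ) :
    sqN q j = q * sqN q (j / 2) + if j.testBit 0 then q else 0 := by
  rw [sqN_eq_sum_range q (Nat.le_succ j), sqN_eq_sum_range q (Nat.div_le_self j 2),
    Finset.sum_range_succ', Finset.mul_sum]
  simp [Nat.testBit_succ, mul_ite, pow_succ']

theorem sqN_two_mul (q : ℝ) (j : ℕ) : sqN q (2 * j) = q * sqN q j := by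
  rw [sqN_eq_div_two]
  simp

theorem sqN_two_mul_add_one (q : ℝ) (j : ℕ) : sqN q (2 * j + 1) = q * sqN q j + q := by
  rw [sqN_eq_div_two, show (2 * j + 1) / 2 = j by omega]
  simp

theorem Sq_two_mul (q : ℝ) (n : ℕ) :
    Sq q (2 * n) = 2 * q * Sq q n + (n : ℝ) * q := by
  induction n with
  | zero => simp [Sq]
  | succ n ih =>
    unfold Sq at ih ⊢
    rw [show 2 * (n + 1) = 2 * n + 1 + 1 by ring, Finset.sum_range_succ, Finset.sum_range_succ,
      ih, Finset.sum_range_succ, sqN_two_mul, sqN_two_mul_add_one]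
    push_cast
    ring

end
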